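/- Let ν > 0 and let (u¹, θ¹) and (u², θ²) be two smooth solutions of the regularized thermoelasticity system on [0,T] with the same initial data: u¹(0,·) = u²(0,·), u¹_t(0,·) = u²_t(0,·) and θ¹(0,·) = θ²(0,·). Then u¹ = u² and θ¹ = θ² on [0,T] × [a,b]. -/

import Mathlib

open Set MeasureTheory

/-- Partial derivative in the first (time) variable. -/
noncomputable def pt (w : ℝ → ℝ → ℝ) (t x : ℝ) : ℝ := deriv (fun s => w s x) t

/-- Partial derivative in the second (space) variable. -/
noncomputable def px (w : ℝ → ℝ → ℝ) (t x : ℝ) : ℝ := deriv (fun y => w t y) x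

/-- Square of the L² norm on (a,b). -/
noncomputable def sqInt (a b : ℝ) (f : ℝ → ℝ) : ℝ := ∫ x in a..b, (f x) ^ 2

/-- The L² norm on (a,b). -/
noncomputable def L2norm (a b : ℝ) (f : ℝ → ℝ) : ℝ := Real.sqrt (sqInt a b f)

/-- A smooth solution of the regularized thermoelasticity system on [0,T] × [a,b]:
`u_tt − u_xx − ν u_txx = −μ θ_x`, `θ_t − θ_xx + μ θ u_tx = 0`,
with Dirichlet boundary conditions for `u` and Neumann boundary conditions for `θ`. -/
def IsRegSolution (a b μ T ν : ℝ) (u θ : ℝ → ℝ → ℝ) : Prop :=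
  ContDiff ℝ (⊤ : ℕ∞) (Function.uncurry u) ∧ ContDiff ℝ (⊤ : ℕ∞) (Function.uncurry θ) ∧
  (∀ t ∈ Set.Icc (0:ℝ) T, ∀ x ∈ Set.Icc a b,
      pt (pt u) t x - px (px u) t x - ν * px (px (pt u)) t x = -μ * px θ t x) ∧
  (∀ t ∈ Set.Icc (0:ℝ) T, ∀ x ∈ Set.Icc a b,
      pt θ t x - px (px θ) t x + μ * θ t x * px (pt u) t x = 0) ∧
  (∀ t ∈ Set.Icc (0:ℝ) T, u t a = 0 ∧ u t b = 0) ∧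
  (∀ t ∈ Set.Icc (0:ℝ) T, px θ t a = 0 ∧ px θ t b = 0)

/-- A smooth function of two variables is differentiable in time, with derivative `pt`. -/
theorem hasDerivAt_pt {w : ℝ → ℝ → ℝ} (hw : ContDiff ℝ (⊤ : ℕ∞) (Function.uncurry w))
    (t x : ℝ) : HasDerivAt (fun s => w s x) (pt w t x) t := by
  have h : Differentiable ℝ (fun s => Function.uncurry w (s, x)) :=
    (hw.comp (by fun_prop : ContDiff ℝ (⊤ : ℕ∞) fun s : ℝ => (s, x))).differentiable (by simp)
  exact (h t).hasDerivAt

/-- A smooth function of two variables is differentiable in space, with derivative `px`. -/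
theorem hasDerivAt_px {w : ℝ → ℝ → ℝ} (hw : ContDiff ℝ (⊤ : ℕ∞) (Function.uncurry w))
    (t x : ℝ) : HasDerivAt (fun y => w t y) (px w t x) x := by
  have h : Differentiable ℝ (fun y => Function.uncurry w (t, y)) :=
    (hw.comp (by fun_prop : ContDiff ℝ (⊤ : ℕ∞) fun y : ℝ => (t, y))).differentiable (by simp)
  exact (h x).hasDerivAt

theorem pt_eq_fderiv {w : ℝ → ℝ → ℝ} (hw : ContDiff ℝ (⊤ : ℕ∞) (Function.uncurry w))
    (t x : ℝ) : pt w t x = fderiv ℝ (Function.uncurry w) (t, x) (1, 0) := by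
  have h := (hw.differentiable (by simp) (t, x)).hasFDerivAt.comp_hasDerivAt t
    ((hasDerivAt_id t).prodMk (hasDerivAt_const t x))
  exact h.deriv

theorem px_eq_fderiv {w : ℝ → ℝ → ℝ} (hw : ContDiff ℝ (⊤ : ℕ∞) (Function.uncurry w))
    (t x : ℝ) : px w t x = fderiv ℝ (Function.uncurry w) (t, x) (0, 1) := by
  have h := (hw.differentiable (by simp) (t, x)).hasFDerivAt.comp_hasDerivAt x
    ((hasDerivAt_const x t).prodMk (hasDerivAt_id x))
  exact h.deriv

theorem contDiff_pt {w : ℝ → ℝ → ℝ} (hw : ContDiff ℝ (⊤ : ℕ∞) (Function.uncurry w)) :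
    ContDiff ℝ (⊤ : ℕ∞) (Function.uncurry (pt w)) := by
  have h : Function.uncurry (pt w) = fun p => fderiv ℝ (Function.uncurry w) p (1, 0) := by
    ext ⟨t, x⟩
    exact pt_eq_fderiv hw t x
  rw [h]
  exact (hw.fderiv_right (m := (⊤ : ℕ∞)) (by simp)).clm_apply contDiff_const

theorem contDiff_px {w : ℝ → ℝ → ℝ} (hw : ContDiff ℝ (⊤ : ℕ∞) (Function.uncurry w)) :
    ContDiff ℝ (⊤ : ℕ∞) (Function.uncurry (px w)) := by
  have h : Function.uncurry (px w) = fun p => fderiv ℝ (Function.uncurry w) p (0, 1) := by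
    ext ⟨t, x⟩
    exact px_eq_fderiv hw t x
  rw [h]
  exact (hw.fderiv_right (m := (⊤ : ℕ∞)) (by simp)).clm_apply contDiff_const

/-- Mixed partial derivatives of a smooth function commute. -/
theorem pt_px_comm {w : ℝ → ℝ → ℝ} (hw : ContDiff ℝ (⊤ : ℕ∞) (Function.uncurry w))
    (t x : ℝ) : pt (px w) t x = px (pt w) t x := by
  have hd : Differentiable ℝ (fderiv ℝ (Function.uncurry w)) :=
    (hw.fderiv_right (m := (⊤ : ℕ∞)) (by simp)).differentiable (by simp)
  have hpx : Function.uncurry (px w) = fun p => fderiv ℝ (Function.uncurry w) p (0, 1) := by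
    ext ⟨t, x⟩
    exact px_eq_fderiv hw t x
  have hpt : Function.uncurry (pt w) = fun p => fderiv ℝ (Function.uncurry w) p (1, 0) := by
    ext ⟨t, x⟩
    exact pt_eq_fderiv hw t x
  have hsymm : IsSymmSndFDerivAt ℝ (Function.uncurry w) (t, x) :=
    hw.contDiffAt.isSymmSndFDerivAt (by
      rw [minSmoothness_of_isRCLikeNormedField]
      exact WithTop.coe_le_coe.2 (le_top : (2 : ℕ∞) ≤ ⊤))
  rw [pt_eq_fderiv (contDiff_px hw), px_eq_fderiv (contDiff_pt hw), hpx, hpt,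
    fderiv_clm_apply (hd _) (by fun_prop), fderiv_clm_apply (hd _) (by fun_prop)]
  simpa using hsymm (1, 0) (0, 1)

theorem pt_sub {v w : ℝ → ℝ → ℝ} (hv : ContDiff ℝ (⊤ : ℕ∞) (Function.uncurry v))
    (hw : ContDiff ℝ (⊤ : ℕ∞) (Function.uncurry w)) :
    pt (fun t x => v t x - w t x) = fun t x => pt v t x - pt w t x := by
  ext t x
  exact ((hasDerivAt_pt hv t x).sub (hasDerivAt_pt hw t x)).deriv

theorem px_sub {v w : ℝ → ℝ → ℝ} (hv : ContDiff ℝ (⊤ : ℕ∞) (Function.uncurry v))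
    (hw : ContDiff ℝ (⊤ : ℕ∞) (Function.uncurry w)) :
    px (fun t x => v t x - w t x) = fun t x => px v t x - px w t x := by
  ext t x
  exact ((hasDerivAt_px hv t x).sub (hasDerivAt_px hw t x)).deriv

/-- The derivative of a function vanishing on a nondegenerate interval vanishes there,
endpoints included. -/
theorem HasDerivAt.eq_zero_of_eqOn_Icc {f : ℝ → ℝ} {f' c d s : ℝ} (hcd : c < d)
    (hf : ∀ r ∈ Icc c d, f r = 0) (hs : s ∈ Icc c d) (h : HasDerivAt f f' s) : f' = 0 :=
  ((uniqueDiffOn_Icc hcd) s hs).eq_deriv _ h.hasDerivWithinAt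
    ((hasDerivWithinAt_const s (Icc c d) (0 : ℝ)).congr hf (hf s hs))

/-- Differentiation under the integral sign for smooth functions on a compact interval. -/
theorem hasDerivAt_integral_pt {e : ℝ → ℝ → ℝ}
    (he : ContDiff ℝ (⊤ : ℕ∞) (Function.uncurry e)) (a b t : ℝ) :
    HasDerivAt (fun s => ∫ x in a..b, e s x) (∫ x in a..b, pt e t x) t := by
  have hc (s : ℝ) : Continuous (e s) :=
    he.continuous.comp (by fun_prop : Continuous fun x : ℝ => (s, x))
  have hc' (s : ℝ) : Continuous (pt e s) :=
    (contDiff_pt he).continuous.comp (by fun_prop : Continuous fun x : ℝ => (s, x))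
  obtain ⟨M, hM⟩ := (isCompact_Icc.prod isCompact_uIcc :
    IsCompact (Icc (t - 1) (t + 1) ×ˢ uIcc a b)).exists_bound_of_continuousOn
      (contDiff_pt he).continuous.continuousOn
  refine (intervalIntegral.hasDerivAt_integral_of_dominated_loc_of_deriv_le
    (s := Icc (t - 1) (t + 1)) (bound := fun _ => M) (Icc_mem_nhds (by linarith) (by linarith))
    (.of_forall fun s => (hc s).aestronglyMeasurable) ((hc t).intervalIntegrable _ _)
    (hc' t).aestronglyMeasurable (.of_forall fun x hx s hs => ?_) intervalIntegrable_const
    (.of_forall fun x _ s _ => hasDerivAt_pt he s x)).2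
  exact hM (s, x) ⟨hs, uIoc_subset_uIcc hx⟩

/-- Energy method: a nonnegative smooth density `e` with zero initial data that satisfies
`e_t ≤ F_x + C e`, for a flux `F` vanishing on the lateral boundary, is identically zero. -/
theorem energy_density_eq_zero {a b T C : ℝ} (hab : a < b) {e F : ℝ → ℝ → ℝ}
    (he : ContDiff ℝ (⊤ : ℕ∞) (Function.uncurry e))
    (hF : ContDiff ℝ (⊤ : ℕ∞) (Function.uncurry F))
    (hnonneg : ∀ t x, 0 ≤ e t x) (hinit : ∀ x ∈ Icc a b, e 0 x = 0)
    (hFa : ∀ t ∈ Icc (0 : ℝ) T, F t a = 0) (hFb : ∀ t ∈ Icc (0 : ℝ) T, F t b = 0)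
    (hle : ∀ t ∈ Icc (0 : ℝ) T, ∀ x ∈ Icc a b, pt e t x ≤ px F t x + C * e t x) :
    ∀ t ∈ Icc (0 : ℝ) T, ∀ x ∈ Icc a b, e t x = 0 := by
  have hslice {w : ℝ → ℝ → ℝ} (hw : ContDiff ℝ (⊤ : ℕ∞) (Function.uncurry w)) (s : ℝ) :
      Continuous (w s) :=
    hw.continuous.comp (by fun_prop : Continuous fun x : ℝ => (s, x))
  have hE (t : ℝ) := hasDerivAt_integral_pt he a b t
  have hE' : ∀ t ∈ Icc (0 : ℝ) T, ∫ x in a..b, pt e t x ≤ C * ∫ x in a..b, e t x := by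
    intro t ht
    have hi1 := (hslice (contDiff_px hF) t).intervalIntegrable (μ := volume) a b
    have hi2 := ((hslice he t).intervalIntegrable (μ := volume) a b).const_mul C
    calc ∫ x in a..b, pt e t x ≤ ∫ x in a..b, (px F t x + C * e t x) :=
          intervalIntegral.integral_mono_on hab.le
            ((hslice (contDiff_pt he) t).intervalIntegrable _ _) (hi1.add hi2) (hle t ht)
      _ = (F t b - F t a) + C * ∫ x in a..b, e t x := by
          rw [intervalIntegral.integral_add hi1 hi2, intervalIntegral.integral_const_mul,
            intervalIntegral.integral_eq_sub_of_hasDerivAt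
              (fun x _ => hasDerivAt_px hF t x) hi1]
      _ = C * ∫ x in a..b, e t x := by rw [hFa t ht, hFb t ht]; ring
  have hg (t : ℝ) : HasDerivAt (fun s => Real.exp (-C * s) * ∫ x in a..b, e s x)
      (Real.exp (-C * t) * (-C) * (∫ x in a..b, e t x)
        + Real.exp (-C * t) * ∫ x in a..b, pt e t x) t := by
    have h := ((hasDerivAt_id t).const_mul (-C)).exp.mul (hE t)
    exact h.congr_deriv (by simp)
  have hanti : AntitoneOn (fun s => Real.exp (-C * s) * ∫ x in a..b, e s x) (Icc 0 T) := by
    refine antitoneOn_of_deriv_nonpos (convex_Icc 0 T)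
      (fun t _ => (hg t).continuousAt.continuousWithinAt)
      (fun t _ => (hg t).differentiableAt.differentiableWithinAt) fun t ht => ?_
    rw [(hg t).deriv]
    have h := hE' t (interior_subset ht)
    nlinarith [Real.exp_pos (-C * t)]
  intro t ht x hx
  by_contra hne
  have hpos : 0 < ∫ y in a..b, e t y :=
    intervalIntegral.integral_pos hab (hslice he t).continuousOn (fun y _ => hnonneg t y)
      ⟨x, hx, lt_of_le_of_ne (hnonneg t x) (Ne.symm hne)⟩
  have h0 : ∫ y in a..b, e 0 y = 0 := by
    rw [intervalIntegral.integral_congr (g := fun _ => (0 : ℝ))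
      fun y hy => hinit y (by rwa [uIcc_of_le hab.le] at hy)]
    simp
  have h := hanti ⟨le_rfl, ht.1.trans ht.2⟩ ht ht.1
  simp only [h0, mul_zero] at h
  exact absurd h (not_le.mpr (mul_pos (Real.exp_pos _) hpos))

/-- **Uniqueness for the regularized (artificial viscosity) problem**, `ν > 0`:
two smooth solutions with the same initial data coincide on `[0,T] × [a,b]`. -/
theorem uniqueness_regularized (a b μ T ν : ℝ) (hab : a < b) (hμ : 0 < μ) (hT : 0 < T)
    (hν : 0 < ν) (u₁ θ₁ u₂ θ₂ : ℝ → ℝ → ℝ)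
    (hsol₁ : IsRegSolution a b μ T ν u₁ θ₁) (hsol₂ : IsRegSolution a b μ T ν u₂ θ₂)
    (hu0 : ∀ x ∈ Icc a b, u₁ 0 x = u₂ 0 x)
    (hu1 : ∀ x ∈ Icc a b, pt u₁ 0 x = pt u₂ 0 x)
    (hθ0 : ∀ x ∈ Icc a b, θ₁ 0 x = θ₂ 0 x) :
    ∀ t ∈ Icc (0:ℝ) T, ∀ x ∈ Icc a b, u₁ t x = u₂ t x ∧ θ₁ t x = θ₂ t x := by
  obtain ⟨hu₁, hθ₁, heq₁, hheat₁, hD₁, hN₁⟩ := hsol₁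
  obtain ⟨hu₂, hθ₂, heq₂, hheat₂, hD₂, hN₂⟩ := hsol₂
  set u : ℝ → ℝ → ℝ := fun t x => u₁ t x - u₂ t x with hu_def
  set θ : ℝ → ℝ → ℝ := fun t x => θ₁ t x - θ₂ t x with hθ_def
  have hu : ContDiff ℝ (⊤ : ℕ∞) (Function.uncurry u) := hu₁.sub hu₂
  have hθ : ContDiff ℝ (⊤ : ℕ∞) (Function.uncurry θ) := hθ₁.sub hθ₂
  have hut := contDiff_pt hu
  have hux := contDiff_px hu
  have hutx := contDiff_px hut
  have hθx := contDiff_px hθ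
  have hwave : ∀ t ∈ Icc (0 : ℝ) T, ∀ x ∈ Icc a b,
      pt (pt u) t x = px (px u) t x + ν * px (px (pt u)) t x - μ * px θ t x := by
    intro t ht x hx
    simp only [hu_def, hθ_def, pt_sub hu₁ hu₂, px_sub hu₁ hu₂, px_sub hθ₁ hθ₂,
      pt_sub (contDiff_pt hu₁) (contDiff_pt hu₂), px_sub (contDiff_pt hu₁) (contDiff_pt hu₂),
      px_sub (contDiff_px hu₁) (contDiff_px hu₂),
      px_sub (contDiff_px (contDiff_pt hu₁)) (contDiff_px (contDiff_pt hu₂))]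
    linarith [heq₁ t ht x hx, heq₂ t ht x hx]
  have hheat : ∀ t ∈ Icc (0 : ℝ) T, ∀ x ∈ Icc a b,
      pt θ t x = px (px θ) t x - μ * (θ₁ t x * px (pt u) t x + θ t x * px (pt u₂) t x) := by
    intro t ht x hx
    simp only [hu_def, hθ_def, pt_sub hu₁ hu₂, pt_sub hθ₁ hθ₂, px_sub hθ₁ hθ₂,
      px_sub (contDiff_pt hu₁) (contDiff_pt hu₂), px_sub (contDiff_px hθ₁) (contDiff_px hθ₂)]
    linarith [hheat₁ t ht x hx, hheat₂ t ht x hx]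
  have hut_bdry : ∀ y, (∀ t ∈ Icc (0 : ℝ) T, u t y = 0) → ∀ t ∈ Icc (0 : ℝ) T, pt u t y = 0 :=
    fun y hy t ht => (hasDerivAt_pt hu t y).eq_zero_of_eqOn_Icc hT hy ht
  have huta := hut_bdry a fun t ht => by simp [hu_def, (hD₁ t ht).1, (hD₂ t ht).1]
  have hutb := hut_bdry b fun t ht => by simp [hu_def, (hD₁ t ht).2, (hD₂ t ht).2]
  have hθxa : ∀ t ∈ Icc (0 : ℝ) T, px θ t a = 0 := fun t ht => by
    simp [hθ_def, px_sub hθ₁ hθ₂, (hN₁ t ht).1, (hN₂ t ht).1]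
  have hθxb : ∀ t ∈ Icc (0 : ℝ) T, px θ t b = 0 := fun t ht => by
    simp [hθ_def, px_sub hθ₁ hθ₂, (hN₁ t ht).2, (hN₂ t ht).2]
  have hcoeff : Continuous fun p : ℝ × ℝ =>
      μ ^ 2 * (1 - Function.uncurry θ₁ p) ^ 2 / (4 * ν)
        - μ * Function.uncurry (px (pt u₂)) p := by
    have h1 := hθ₁.continuous
    have h2 := (contDiff_px (contDiff_pt hu₂)).continuous
    fun_prop
  obtain ⟨K, hK⟩ := (isCompact_Icc.prod isCompact_Icc :
    IsCompact (Icc (0 : ℝ) T ×ˢ Icc a b)).exists_bound_of_continuousOn hcoeff.continuousOn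
  have hK0 : 0 ≤ K := (norm_nonneg _).trans
    (hK (0, a) ⟨⟨le_rfl, hT.le⟩, ⟨le_rfl, hab.le⟩⟩)
  have hzero := energy_density_eq_zero (T := T) (C := 2 * K) hab
    (e := fun t x => (pt u t x ^ 2 + px u t x ^ 2 + θ t x ^ 2) / 2)
    (F := fun t x => pt u t x * (px u t x + ν * px (pt u) t x - μ * θ t x) + θ t x * px θ t x)
    (((hut.pow 2).add (hux.pow 2)).add (hθ.pow 2) |>.div_const 2)
    ((hut.mul ((hux.add (contDiff_const.mul hutx)).sub (contDiff_const.mul hθ))).add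
      (hθ.mul hθx))
    (fun t x => by positivity)
    (fun x hx => by
      have h1 : pt u 0 x = 0 := by simp [hu_def, pt_sub hu₁ hu₂, hu1 x hx]
      have h2 : px u 0 x = 0 := (hasDerivAt_px hu 0 x).eq_zero_of_eqOn_Icc hab
        (fun y hy => by simp [hu_def, hu0 y hy]) hx
      have h3 : θ 0 x = 0 := by simp [hθ_def, hθ0 x hx]
      simp [h1, h2, h3])
    (fun t ht => by simp [huta t ht, hθxa t ht])
    (fun t ht => by simp [hutb t ht, hθxb t ht])
    (fun t ht x hx => by
      have het : pt (fun t x => (pt u t x ^ 2 + px u t x ^ 2 + θ t x ^ 2) / 2) t x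
          = pt u t x * pt (pt u) t x + px u t x * px (pt u) t x + θ t x * pt θ t x := by
        have h := ((((hasDerivAt_pt hut t x).pow 2).add ((hasDerivAt_pt hux t x).pow 2)).add
          ((hasDerivAt_pt hθ t x).pow 2)).div_const 2
        rw [pt_px_comm hu] at h
        refine h.deriv.trans ?_
        simp
        ring
      have hFx : px (fun t x => pt u t x * (px u t x + ν * px (pt u) t x - μ * θ t x)
            + θ t x * px θ t x) t x
          = px (pt u) t x * (px u t x + ν * px (pt u) t x - μ * θ t x)
            + pt u t x * (px (px u) t x + ν * px (px (pt u)) t x - μ * px θ t x)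
            + (px θ t x * px θ t x + θ t x * px (px θ) t x) :=
        (((hasDerivAt_px hut t x).mul (((hasDerivAt_px hux t x).add
          ((hasDerivAt_px hutx t x).const_mul ν)).sub ((hasDerivAt_px hθ t x).const_mul μ))).add
          ((hasDerivAt_px hθ t x).mul (hasDerivAt_px hθx t x))).deriv
      have hKx : μ ^ 2 * (1 - θ₁ t x) ^ 2 / (4 * ν) - μ * px (pt u₂) t x ≤ K :=
        (le_abs_self _).trans (hK (t, x) ⟨ht, hx⟩)
      have hyoung : μ * (1 - θ₁ t x) * px (pt u) t x * θ t x
          ≤ ν * px (pt u) t x ^ 2 + μ ^ 2 * (1 - θ₁ t x) ^ 2 / (4 * ν) * θ t x ^ 2 := by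
        have h : ν * px (pt u) t x ^ 2 + μ ^ 2 * (1 - θ₁ t x) ^ 2 / (4 * ν) * θ t x ^ 2
            - μ * (1 - θ₁ t x) * px (pt u) t x * θ t x
            = (2 * ν * px (pt u) t x - μ * (1 - θ₁ t x) * θ t x) ^ 2 / (4 * ν) := by
          field_simp
          ring
        have h' : 0 ≤ (2 * ν * px (pt u) t x - μ * (1 - θ₁ t x) * θ t x) ^ 2 / (4 * ν) := by
          positivity
        linarith
      rw [het, hFx, hwave t ht x hx, hheat t ht x hx]
      have h1 := mul_le_mul_of_nonneg_right hKx (sq_nonneg (θ t x))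
      have h2 := mul_nonneg hK0 (sq_nonneg (pt u t x))
      have h3 := mul_nonneg hK0 (sq_nonneg (px u t x))
      linarith [sq_nonneg (px θ t x)])
  have hut0 : ∀ t ∈ Icc (0 : ℝ) T, ∀ x ∈ Icc a b, pt u t x = 0 := fun t ht x hx => by
    have h := hzero t ht x hx
    have : pt u t x ^ 2 = 0 := by
      linarith [sq_nonneg (pt u t x), sq_nonneg (px u t x), sq_nonneg (θ t x)]
    simpa using this
  intro t ht x hx
  constructor
  · have hconst := constant_of_derivWithin_zero (f := fun s => u s x) (a := 0) (b := T)
      (fun s _ => (hasDerivAt_pt hu s x).differentiableAt.differentiableWithinAt)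
      (fun s hs => ((hasDerivAt_pt hu s x).hasDerivWithinAt.derivWithin
        (uniqueDiffOn_Icc hT s (Ico_subset_Icc_self hs))).trans
          (hut0 s (Ico_subset_Icc_self hs) x hx)) t ht
    simp only [hu_def, hu0 x hx, sub_self] at hconst
    exact sub_eq_zero.mp hconst
  · have h := hzero t ht x hx
    have h' : θ t x ^ 2 = 0 := by
      linarith [sq_nonneg (pt u t x), sq_nonneg (px u t x), sq_nonneg (θ t x)]
    exact sub_eq_zero.mp (by simpa using h')
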